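/- arXiv:2211.09020 — 9 statements merged into one kernel-verified Lean document; each statement's English description precedes it below -/
import Mathlib

section
/- Let τ be a fulfilled CCv trace with τ ⊨ CCv, let x be a variable, and let t₁, t₂ ∈ W x with t₁ ≠ t₂ be such that (po ∪ rf ∪ co)⁺ t₂ t₁ does not hold. Then the trace τ ⊙ (t₁, t₂) satisfies τ ⊙ (t₁, t₂) ⊨ CCv. -/
open Relation

/-- A CCv trace: transactions `T`, per-variable write/read sets `W`, `R`,
program order `po`, per-variable reads-from `rf` and coherence `co`. -/
structure CCvTrace (α V : Type*) where
  T : Set α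
  W : V → Set α
  R : V → Set α
  po : α → α → Prop
  rf : V → α → α → Prop
  co : V → α → α → Prop
  W_sub : ∀ x, W x ⊆ T
  R_sub : ∀ x, R x ⊆ T
  po_mem : ∀ a b, po a b → a ∈ T ∧ b ∈ T
  rf_mem : ∀ x a b, rf x a b → a ∈ W x ∧ b ∈ R x
  co_mem : ∀ x a b, co x a b → a ∈ W x ∧ b ∈ W x

namespace CCvTrace

variable {α V : Type*}

/-- The union of the reads-from relations over all variables. -/
def rfU (τ : CCvTrace α V) (a b : α) : Prop := ∃ x, τ.rf x a b

/-- The union of the coherence relations over all variables. -/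
def coU (τ : CCvTrace α V) (a b : α) : Prop := ∃ x, τ.co x a b

/-- po ∪ rf. -/
def porf (τ : CCvTrace α V) (a b : α) : Prop := τ.po a b ∨ τ.rfU a b

/-- po ∪ rf ∪ co. -/
def porfco (τ : CCvTrace α V) (a b : α) : Prop := τ.porf a b ∨ τ.coU a b

/-- po ∪ rf ∪ co^x. -/
def porfcox (τ : CCvTrace α V) (x : V) (a b : α) : Prop := τ.porf a b ∨ τ.co x a b

/-- A trace is fulfilled if whenever `(po ∪ rf ∪ co^x)⁺ t t''` and `rf^x t' t''`
for distinct writers `t ≠ t'` of `x`, then `(po ∪ rf ∪ co^x)⁺ t t'`. -/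
def Fulfilled (τ : CCvTrace α V) : Prop :=
  ∀ x t t' t'', t ∈ τ.W x → t' ∈ τ.W x → t ≠ t' →
    TransGen (τ.porfcox x) t t'' → τ.rf x t' t'' →
    TransGen (τ.porfcox x) t t'

/-- τ ⊨ CCv (partially good). -/
def SatCCv (τ : CCvTrace α V) : Prop :=
  (∀ x t₁ t₂ t₃, t₁ ∈ τ.W x → t₃ ∈ τ.W x → t₃ ≠ t₁ → t₂ ∈ τ.R x →
      τ.rf x t₁ t₂ → TransGen τ.porf t₃ t₂ → τ.co x t₃ t₁) ∧
  (∀ a, ¬ TransGen τ.porfco a a)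

/-- The trace is total: each `co^x` is a strict total order on `W x`. -/
def IsTotal (τ : CCvTrace α V) : Prop :=
  ∀ x, (∀ a, ¬ τ.co x a a) ∧
    (∀ a b c, τ.co x a b → τ.co x b c → τ.co x a c) ∧
    (∀ a b, a ∈ τ.W x → b ∈ τ.W x → a ≠ b → τ.co x a b ∨ τ.co x b a)

/-- τ ⊑ τ' : same transactions, write/read sets, po and rf; co only grows. -/
def Weaker (τ τ' : CCvTrace α V) : Prop :=
  τ.T = τ'.T ∧ τ.W = τ'.W ∧ τ.R = τ'.R ∧ τ.po = τ'.po ∧ τ.rf = τ'.rf ∧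
  ∀ x a b, τ.co x a b → τ'.co x a b

/-- τ is CCv-consistent: it extends to a total trace satisfying CCv. -/
def CCvConsistent (τ : CCvTrace α V) : Prop :=
  ∃ τ' : CCvTrace α V, τ.Weaker τ' ∧ τ'.IsTotal ∧ τ'.SatCCv

/-- τ ⊙ (t₁, t₂): add the pair (t₁, t₂) to co^x. -/
def addCo (τ : CCvTrace α V) (x : V) (t₁ t₂ : α) (h₁ : t₁ ∈ τ.W x) (h₂ : t₂ ∈ τ.W x) :
    CCvTrace α V where
  T := τ.T
  W := τ.W
  R := τ.R
  po := τ.po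
  rf := τ.rf
  co := fun y a b => τ.co y a b ∨ (y = x ∧ a = t₁ ∧ b = t₂)
  W_sub := τ.W_sub
  R_sub := τ.R_sub
  po_mem := τ.po_mem
  rf_mem := τ.rf_mem
  co_mem := by
    rintro y a b (h | ⟨rfl, rfl, rfl⟩)
    · exact τ.co_mem y a b h
    · exact ⟨h₁, h₂⟩

end CCvTrace

/-- A path in a relation extended by the single pair `(u, v)` either avoids the new pair, or
decomposes into a path reaching `u` and a path leaving `v`. -/
theorem Relation.TransGen.of_add_pair {α : Type*} {r s : α → α → Prop} {u v : α}
    (hs : ∀ a b, s a b → r a b ∨ (a = u ∧ b = v)) {a b : α} (h : TransGen s a b) :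
    TransGen r a b ∨ (ReflTransGen r a u ∧ ReflTransGen r v b) := by
  induction h with
  | single h =>
    rcases hs _ _ h with h | ⟨rfl, rfl⟩
    · exact .inl (.single h)
    · exact .inr ⟨.refl, .refl⟩
  | tail _ h ih =>
    rcases hs _ _ h with h | ⟨rfl, rfl⟩
    · exact ih.imp (·.tail h) fun ⟨hu, hv⟩ => ⟨hu, hv.tail h⟩
    · exact .inr ⟨ih.elim TransGen.to_reflTransGen And.left, .refl⟩

open Relation CCvTrace in
/-- if τ is fulfilled, τ ⊨ CCv and ¬(po ∪ rf ∪ co)⁺ t₂ t₁,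
then τ ⊙ (t₁, t₂) ⊨ CCv. -/
theorem satCCv_addCo {α V : Type*} (τ : CCvTrace α V) (x : V) (t₁ t₂ : α)
    (h₁ : t₁ ∈ τ.W x) (h₂ : t₂ ∈ τ.W x) (hne : t₁ ≠ t₂)
    (hful : τ.Fulfilled) (hsat : τ.SatCCv)
    (hnp : ¬ TransGen τ.porfco t₂ t₁) :
    (τ.addCo x t₁ t₂ h₁ h₂).SatCCv := by
  refine ⟨fun y a b c ha hc hca hb hrf hp => .inl (hsat.1 y a b c ha hc hca hb hrf hp),
    fun a ha => ?_⟩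
  have hstep : ∀ b c, (τ.addCo x t₁ t₂ h₁ h₂).porfco b c →
      τ.porfco b c ∨ (b = t₁ ∧ c = t₂) := by
    rintro b c (h | ⟨y, h | ⟨_, hb, hc⟩⟩)
    · exact .inl (.inl h)
    · exact .inl (.inr ⟨y, h⟩)
    · exact .inr ⟨hb, hc⟩
  rcases ha.of_add_pair hstep with h | ⟨hu, hv⟩
  · exact hsat.2 a h
  · rcases reflTransGen_iff_eq_or_transGen.mp (hv.trans hu) with h | h
    · exact hne h
    · exact hnp h
end

section
/- Let τ be a CCv trace whose transaction set T is finite. If τ is fulfilled and partially good (τ ⊨ CCv), then τ is CCv-consistent: there exists a total trace τ' with τ ⊑ τ' and τ' ⊨ CCv. -/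
open Relation

namespace CCvTrace

/-- The trace `τ` with each `co^x` replaced by the restriction of `s` to the writers of `x`. -/
def withCo {α V : Type*} (τ : CCvTrace α V) (s : α → α → Prop) : CCvTrace α V where
  T := τ.T
  W := τ.W
  R := τ.R
  po := τ.po
  rf := τ.rf
  co := fun x a b => a ∈ τ.W x ∧ b ∈ τ.W x ∧ s a b
  W_sub := τ.W_sub
  R_sub := τ.R_sub
  po_mem := τ.po_mem
  rf_mem := τ.rf_mem
  co_mem := fun _ _ _ h => ⟨h.1, h.2.1⟩

/-- A partially good trace is CCv-consistent: restrict a linear extension of the acyclic relation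
`po ∪ rf ∪ co` to the writers of each variable. -/
theorem SatCCv.ccvConsistent {α V : Type*} {τ : CCvTrace α V} (h : τ.SatCCv) :
    τ.CCvConsistent := by
  obtain ⟨hread, hacyc⟩ := h
  have : IsPartialOrder α (Relation.ReflTransGen τ.porfco) :=
    { refl := fun _ => .refl
      trans := fun _ _ _ => .trans
      antisymm := fun a b hab hba => by
        rcases Relation.reflTransGen_iff_eq_or_transGen.1 hab with rfl | hab
        · rfl
        · exact (hacyc a (hab.trans_left hba)).elim }
  obtain ⟨s, hs, hle⟩ := extend_partialOrder (Relation.ReflTransGen τ.porfco)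
  have trans : ∀ {a b c}, s a b → s b c → s a c := fun h₁ h₂ => hs.trans _ _ _ h₁ h₂
  have antisymm : ∀ {a b}, s a b → s b a → a = b := fun h₁ h₂ => hs.antisymm _ _ h₁ h₂
  have lt_of_porfco : ∀ {a b}, τ.porfco a b → s a b ∧ a ≠ b := fun {a b} hab =>
    ⟨hle _ _ (.single hab), fun e => hacyc a (.single (e ▸ hab))⟩
  have co_lift : ∀ x a b, τ.co x a b → (τ.withCo fun a b => s a b ∧ a ≠ b).co x a b :=
    fun x a b hab => ⟨(τ.co_mem x a b hab).1, (τ.co_mem x a b hab).2,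
      lt_of_porfco (.inr ⟨x, hab⟩)⟩
  refine ⟨τ.withCo fun a b => s a b ∧ a ≠ b, ⟨rfl, rfl, rfl, rfl, rfl, co_lift⟩,
    fun x => ⟨?_, ?_, ?_⟩,
    fun x t₁ t₂ t₃ h₁ h₃ hne h₂ hrf hpath => co_lift _ _ _ (hread x t₁ t₂ t₃ h₁ h₃ hne h₂ hrf hpath),
    fun a ha => ?_⟩
  · exact fun a ha => ha.2.2.2 rfl
  · rintro a b c ⟨ha, -, hab, hne⟩ ⟨-, hc, hbc, -⟩
    exact ⟨ha, hc, trans hab hbc, fun e => hne (antisymm hab (e ▸ hbc))⟩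
  · intro a b ha hb hne
    rcases hs.total a b with hab | hba
    · exact .inl ⟨ha, hb, hab, hne⟩
    · exact .inr ⟨hb, ha, hba, hne.symm⟩
  · have lt_of_path : ∀ {b}, Relation.TransGen
        (τ.withCo fun a b => s a b ∧ a ≠ b).porfco a b → s a b ∧ a ≠ b := by
      have step : ∀ {b c}, (τ.withCo fun a b => s a b ∧ a ≠ b).porfco b c → s b c ∧ b ≠ c := by
        rintro b c (hbc | ⟨x, -, -, hbc⟩)
        · exact lt_of_porfco (.inl hbc)
        · exact hbc
      intro b hb
      induction hb with
      | single hab => exact step hab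
      | tail _ hbc ih =>
        exact ⟨trans ih.1 (step hbc).1, fun e => (step hbc).2 (antisymm (step hbc).1 (e ▸ ih.1))⟩
    exact (lt_of_path ha).2 rfl

end CCvTrace

open Relation CCvTrace in
/-- a fulfilled, partially good trace with finite transaction set
is CCv-consistent. -/
theorem ccvConsistent_of_fulfilled_satCCv {α V : Type*} (τ : CCvTrace α V)
    (hfin : τ.T.Finite) (hful : τ.Fulfilled) (hsat : τ.SatCCv) :
    τ.CCvConsistent := by
  exact hsat.ccvConsistent
end

section
/- Let τ be a fulfilled CCv trace and let τ' be obtained from τ by a begin step, adding a fresh transaction t ∉ T together with a single new po edge (t₀, t) for some t₀ ∈ T, and leaving rf and co unchanged. Then τ' is fulfilled. -/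
open Relation

namespace CCvTrace

variable {α V : Type*}

open Relation

/-- cond1 for candidate source `t'` of a read of `x` in `t`. -/
def cond1 (τ : CCvTrace α V) (x : V) (t t' : α) : Prop :=
  ∃ t₃, t₃ ∈ τ.W x ∧ TransGen τ.porfco t' t₃ ∧ TransGen τ.porf t₃ t

/-- cond2. -/
def cond2 (τ : CCvTrace α V) (x : V) (t t' : α) : Prop :=
  ∃ y t₄, y ≠ x ∧ t₄ ≠ t' ∧ t' ∈ τ.W y ∧ t' ∈ τ.W x ∧ t₄ ∈ τ.W y ∧ t₄ ∈ τ.W x ∧ τ.rf y t₄ t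

/-- cond3. -/
def cond3 (τ : CCvTrace α V) (x : V) (t t' : α) : Prop :=
  ∃ y t₃ t₄, y ≠ x ∧ t' ∈ τ.W y ∧ τ.rf y t₄ t ∧ TransGen τ.porfco t₄ t₃ ∧
    ReflTransGen τ.porf t₃ t' ∧ t₃ ∈ τ.W y

/-- cond4. -/
def cond4 (τ : CCvTrace α V) (x : V) (t t' : α) : Prop :=
  ∃ y t₃ t₄, y ≠ x ∧ t' ∈ τ.W y ∧ τ.rf y t₄ t ∧ TransGen τ.porfco t₄ t₃ ∧
    TransGen τ.porf t₃ t ∧ t₃ ∈ τ.W x ∧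
    ¬ ∃ t'', t'' ∈ τ.W x ∧ TransGen τ.porfco t₃ t'' ∧ TransGen τ.porf t'' t

/-- The readable set rbl(τ, t, x). -/
def rbl (τ : CCvTrace α V) (t : α) (x : V) : Set α :=
  {t' | t' ∈ τ.W x ∧ ¬ τ.cond1 x t t' ∧ ¬ τ.cond2 x t t' ∧ ¬ τ.cond3 x t t' ∧ ¬ τ.cond4 x t t'}

/-- The visible set vbl(τ, t, x). -/
def vbl (τ : CCvTrace α V) (t : α) (x : V) : Set α :=
  {t'' | t'' ∈ τ.rbl t x ∧ TransGen τ.porf t'' t}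

/-- `t` has no outgoing po, rf or co edges. -/
def NoOut (τ : CCvTrace α V) (t : α) : Prop :=
  (∀ s, ¬ τ.po t s) ∧ (∀ y s, ¬ τ.rf y t s) ∧ (∀ y s, ¬ τ.co y t s)

/-- The begin step: add a fresh transaction `t ∉ T` with one new po edge `(t₀, t)`. -/
def beginStep (τ : CCvTrace α V) (t t₀ : α) (hnew : t ∉ τ.T) (h₀ : t₀ ∈ τ.T) :
    CCvTrace α V where
  T := τ.T ∪ {t}
  W := τ.W
  R := τ.R
  po := fun a b => τ.po a b ∨ (a = t₀ ∧ b = t)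
  rf := τ.rf
  co := τ.co
  W_sub := fun x a ha => Set.mem_union_left _ (τ.W_sub x ha)
  R_sub := fun x a ha => Set.mem_union_left _ (τ.R_sub x ha)
  po_mem := by
    rintro a b (h | ⟨ha, hb⟩)
    · exact ⟨Set.mem_union_left _ (τ.po_mem a b h).1, Set.mem_union_left _ (τ.po_mem a b h).2⟩
    · exact ⟨ha ▸ Set.mem_union_left _ h₀, Set.mem_union_right _ hb⟩
  rf_mem := τ.rf_mem
  co_mem := τ.co_mem

/-- The read step: `t ∈ R x` reads `x` from `t' ∈ rbl(τ, t, x)`: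
add the rf^x edge (t', t), the co^x edges from the visible transactions to `t'`,
and for `y ≠ x` written by `t'`, the co^y edges from `t'` to the rf^y sources of `t`. -/
def readStep (τ : CCvTrace α V) (x : V) (t t' : α)
    (ht : t ∈ τ.R x) (ht' : t' ∈ τ.rbl t x) : CCvTrace α V where
  T := τ.T
  W := τ.W
  R := τ.R
  po := τ.po
  rf := fun y a b => τ.rf y a b ∨ (y = x ∧ a = t' ∧ b = t)
  co := fun y a b => τ.co y a b ∨
    (y = x ∧ b = t' ∧ a ∈ τ.vbl t x ∧ a ≠ t') ∨
    (y ≠ x ∧ t' ∈ τ.W y ∧ a = t' ∧ b ≠ t' ∧ τ.rf y b t)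
  W_sub := τ.W_sub
  R_sub := τ.R_sub
  po_mem := τ.po_mem
  rf_mem := by
    rintro y a b (h | ⟨rfl, rfl, rfl⟩)
    · exact τ.rf_mem y a b h
    · exact ⟨ht'.1, ht⟩
  co_mem := by
    rintro y a b (h | ⟨rfl, rfl, hv, hne⟩ | ⟨hy, hw, rfl, hne, hrf⟩)
    · exact τ.co_mem y a b h
    · exact ⟨hv.1.1, ht'.1⟩
    · exact ⟨hw, (τ.rf_mem y b t hrf).1⟩

end CCvTrace

namespace CCvTrace

theorem porfcox_left_mem {α V : Type*} (τ : CCvTrace α V) {x : V} {a b : α}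
    (h : τ.porfcox x a b) : a ∈ τ.T := by
  rcases h with (h | ⟨y, h⟩) | h
  · exact (τ.po_mem a b h).1
  · exact τ.W_sub y (τ.rf_mem y a b h).1
  · exact τ.W_sub x (τ.co_mem x a b h).1

theorem porfcox_beginStep_iff {α V : Type*} (τ : CCvTrace α V) {t t₀ : α}
    (hnew : t ∉ τ.T) (h₀ : t₀ ∈ τ.T) {x : V} {a b : α} :
    (τ.beginStep t t₀ hnew h₀).porfcox x a b ↔ τ.porfcox x a b ∨ (a = t₀ ∧ b = t) := by
  simp only [porfcox, porf, rfU, beginStep]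
  tauto

/-- Paths of the extended trace that end at an old transaction are paths of the old trace. -/
theorem transGen_porfcox_of_beginStep {α V : Type*} (τ : CCvTrace α V) {t t₀ : α}
    (hnew : t ∉ τ.T) (h₀ : t₀ ∈ τ.T) {x : V} {a b : α}
    (h : TransGen ((τ.beginStep t t₀ hnew h₀).porfcox x) a b) (hb : b ∈ τ.T) :
    TransGen (τ.porfcox x) a b := by
  have old {c d : α} (hd : d ∈ τ.T) (hcd : (τ.beginStep t t₀ hnew h₀).porfcox x c d) :
      τ.porfcox x c d :=
    ((τ.porfcox_beginStep_iff hnew h₀).1 hcd).resolve_right fun e => hnew (e.2 ▸ hd)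
  induction h with
  | single hab => exact .single (old hb hab)
  | tail _ hcd ih => exact .tail (ih (τ.porfcox_left_mem (old hb hcd))) (old hb hcd)

end CCvTrace

open Relation CCvTrace in
/-- the begin step preserves fulfilledness. -/
theorem fulfilled_beginStep {α V : Type*} (τ : CCvTrace α V) (t t₀ : α)
    (hnew : t ∉ τ.T) (h₀ : t₀ ∈ τ.T) (hful : τ.Fulfilled) :
    (τ.beginStep t t₀ hnew h₀).Fulfilled := by
  intro x a b c ha hb hab hac hbc
  have hc : c ∈ τ.T := τ.R_sub x (τ.rf_mem x b c hbc).2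
  exact TransGen.mono (fun _ _ h => (τ.porfcox_beginStep_iff hnew h₀).2 (.inl h)) _ _
    (hful x a b c ha hb hab (τ.transGen_porfcox_of_beginStep hnew h₀ hac hc) hbc)
end

section
/- Let τ be a CCv trace with τ ⊨ CCv and let τ' be obtained from τ by a begin step, adding a fresh transaction t ∉ T together with a single new po edge (t₀, t) for some t₀ ∈ T, and leaving rf and co unchanged. Then τ' ⊨ CCv. -/
open Relation

/-- A path not ending at a vertex `t` without outgoing edges uses no edge into `t`. -/
theorem Relation.TransGen.of_sink {α : Type*} {r s : α → α → Prop} {t : α}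
    (hsink : ∀ b, ¬ s t b) (h : ∀ a b, b ≠ t → s a b → r a b) {a b : α}
    (hab : Relation.TransGen s a b) (hb : b ≠ t) : Relation.TransGen r a b := by
  induction hab with
  | single hab => exact .single (h _ _ hb hab)
  | @tail b c _ hbc ih => exact (ih fun e => hsink c (e ▸ hbc)).tail (h _ _ hb hbc)

namespace CCvTrace

variable {α V : Type*} {τ : CCvTrace α V}

theorem mem_left_of_porfco {a b : α} (h : τ.porfco a b) : a ∈ τ.T := by
  rcases h with (h | ⟨x, h⟩) | ⟨x, h⟩
  · exact (τ.po_mem a b h).1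
  · exact τ.W_sub x (τ.rf_mem x a b h).1
  · exact τ.W_sub x (τ.co_mem x a b h).1

variable {t t₀ : α} {hnew : t ∉ τ.T} {h₀ : t₀ ∈ τ.T}

theorem not_porfco_beginStep (b : α) : ¬ (τ.beginStep t t₀ hnew h₀).porfco t b := by
  rintro (((h | ⟨rfl, -⟩) | h) | h)
  · exact hnew (τ.po_mem t b h).1
  · exact hnew h₀
  · exact hnew (mem_left_of_porfco (.inl (.inr h)))
  · exact hnew (mem_left_of_porfco (.inr h))

theorem porf_of_porf_beginStep {a b : α} (hb : b ≠ t)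
    (h : (τ.beginStep t t₀ hnew h₀).porf a b) : τ.porf a b := by
  rcases h with (h | ⟨-, rfl⟩) | h
  · exact .inl h
  · exact absurd rfl hb
  · exact .inr h

end CCvTrace

open Relation CCvTrace in
/-- the begin step preserves τ ⊨ CCv. -/
theorem satCCv_beginStep {α V : Type*} (τ : CCvTrace α V) (t t₀ : α)
    (hnew : t ∉ τ.T) (h₀ : t₀ ∈ τ.T) (hsat : τ.SatCCv) :
    (τ.beginStep t t₀ hnew h₀).SatCCv := by
  refine ⟨fun x t₁ t₂ t₃ h₁ h₃ hne h₂ hrf hpath => ?_, fun a ha => ?_⟩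
  · exact hsat.1 x t₁ t₂ t₃ h₁ h₃ hne h₂ hrf <|
      hpath.of_sink (fun b h => not_porfco_beginStep b (.inl h))
        (fun _ _ => porf_of_porf_beginStep) fun e => hnew (e ▸ τ.R_sub x h₂)
  · have hat : a ≠ t := by
      rintro rfl
      obtain ⟨b, hab, -⟩ := TransGen.head'_iff.1 ha
      exact not_porfco_beginStep b hab
    exact hsat.2 a <| ha.of_sink not_porfco_beginStep
      (fun _ _ hb h => h.imp (porf_of_porf_beginStep hb) id) hat
end

section
/- Let τ = (T, po, rf, co) be a CCv trace, let t ∈ R x be a transaction with no outgoing po, rf or co edges, and let t' ∈ W x. Let τ₂ = (T, po, rf₂, co₂) be a trace that agrees with τ except that rf₂^x = rf^x ∪ {(t', t)} and co^y ⊆ co₂^y for every variable y. If τ₂ ⊨ CCv, then t' ∈ rbl(τ, t, x), i.e., none of cond1, cond2, cond3, cond4 holds for t, x and t' in τ. -/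
open Relation

namespace CCvTrace

/-- In a trace satisfying CCv, a writer of `x` that happens before a reader of `x` is not
`(po ∪ rf ∪ co)⁺`-after the transaction which that reader reads `x` from. -/
theorem SatCCv.not_transGen_porfco {α V : Type*} {τ : CCvTrace α V} (h : τ.SatCCv)
    {x : V} {a b c : α} (hab : τ.rf x a b) (hc : c ∈ τ.W x) (hcb : TransGen τ.porf c b) :
    ¬ TransGen τ.porfco a c := by
  intro hac
  have hne : c ≠ a := by
    rintro rfl
    exact h.2 c hac
  have hm := τ.rf_mem x a b hab
  exact h.2 a (hac.tail (.inr ⟨x, h.1 x a b c hm.1 hc hne hm.2 hab hcb⟩))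

/-- In a trace satisfying CCv, a writer of `x` that happens before a reader of `x` is
`(po ∪ rf ∪ co)*`-before the transaction which that reader reads `x` from. -/
theorem SatCCv.reflTransGen_porfco {α V : Type*} {τ : CCvTrace α V} (h : τ.SatCCv)
    {x : V} {a b c : α} (hab : τ.rf x a b) (hc : c ∈ τ.W x) (hcb : TransGen τ.porf c b) :
    ReflTransGen τ.porfco c a := by
  by_cases hne : c = a
  · exact hne ▸ .refl
  · have hm := τ.rf_mem x a b hab
    exact .single (.inr ⟨x, h.1 x a b c hm.1 hc hne hm.2 hab hcb⟩)

end CCvTrace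

open Relation CCvTrace in
/-- if a trace τ₂ agreeing with τ except for the extra rf^x edge
(t', t) and possibly larger coherence relations satisfies CCv, then
`t' ∈ rbl(τ, t, x)`. -/
theorem readable_of_satCCv {α V : Type*} (τ τ₂ : CCvTrace α V) (x : V) (t t' : α)
    (ht : t ∈ τ.R x) (ht' : t' ∈ τ.W x) (hno : τ.NoOut t)
    (hT : τ₂.T = τ.T) (hW : τ₂.W = τ.W) (hR : τ₂.R = τ.R) (hpo : τ₂.po = τ.po)
    (hrfx : ∀ a b, τ₂.rf x a b ↔ (τ.rf x a b ∨ (a = t' ∧ b = t)))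
    (hrfy : ∀ y, y ≠ x → ∀ a b, τ₂.rf y a b ↔ τ.rf y a b)
    (hco : ∀ y a b, τ.co y a b → τ₂.co y a b)
    (hsat : τ₂.SatCCv) :
    t' ∈ τ.rbl t x := by
  have rf_le : ∀ y a b, τ.rf y a b → τ₂.rf y a b := by
    intro y a b h
    by_cases hy : y = x
    · subst hy
      exact (hrfx a b).2 (.inl h)
    · exact (hrfy y hy a b).2 h
  have porf_le : ∀ a b, τ.porf a b → τ₂.porf a b := by
    rintro a b (h | ⟨y, h⟩)
    · exact .inl (hpo ▸ h)
    · exact .inr ⟨y, rf_le y a b h⟩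
  have porfco_le : ∀ a b, τ.porfco a b → τ₂.porfco a b := by
    rintro a b (h | ⟨y, h⟩)
    · exact .inl (porf_le a b h)
    · exact .inr ⟨y, hco y a b h⟩
  have hrf : τ₂.rf x t' t := (hrfx t' t).2 (.inr ⟨rfl, rfl⟩)
  have hporf : τ₂.porf t' t := .inr ⟨x, hrf⟩
  refine ⟨ht', ?_, ?_, ?_, ?_⟩
  · rintro ⟨t₃, h₃, h', h₃t⟩
    exact hsat.not_transGen_porfco hrf (hW ▸ h₃) (h₃t.lift id porf_le) (h'.lift id porfco_le)
  · rintro ⟨y, t₄, -, hne, hy', -, hy₄, hx₄, h₄t⟩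
    have h₄t₂ := rf_le y t₄ t h₄t
    have h₄' := hsat.reflTransGen_porfco hrf (hW ▸ hx₄) (.single (.inr ⟨y, h₄t₂⟩))
    rcases reflTransGen_iff_eq_or_transGen.1 h₄' with h | h
    · exact hne h.symm
    · exact hsat.not_transGen_porfco h₄t₂ (hW ▸ hy') (.single hporf) h
  · rintro ⟨y, t₃, t₄, -, -, h₄t, h₄₃, h₃', hy₃⟩
    exact hsat.not_transGen_porfco (rf_le y t₄ t h₄t) (hW ▸ hy₃)
      (.tail' (h₃'.lift id porf_le) hporf) (h₄₃.lift id porfco_le)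
  · rintro ⟨y, t₃, t₄, -, hy', h₄t, h₄₃, h₃t, hx₃, -⟩
    have h₃' := hsat.reflTransGen_porfco hrf (hW ▸ hx₃) (h₃t.lift id porf_le)
    exact hsat.not_transGen_porfco (rf_le y t₄ t h₄t) (hW ▸ hy') (.single hporf)
      ((h₄₃.lift id porfco_le).trans_left h₃')
end

section
/- Let τ and τ' be CCv traces with τ ⊑ τ', with finite transaction set T, and suppose (po ∪ rf ∪ co')⁺ is irreflexive, where co' is the coherence relation of τ'. Then for every transaction t ∈ R x and every variable x, rbl(τ', t, x) ⊆ rbl(τ, t, x). -/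
open Relation

namespace CCvTrace

variable {α V : Type*}

theorem Weaker.porf_eq {τ τ' : CCvTrace α V} (hw : τ.Weaker τ') : τ'.porf = τ.porf := by
  obtain ⟨-, -, -, hpo, hrf, -⟩ := hw
  funext a b
  simp only [porf, rfU, hpo, hrf]

theorem Weaker.transGen_porfco {τ τ' : CCvTrace α V} (hw : τ.Weaker τ') {a b : α}
    (h : TransGen τ.porfco a b) : TransGen τ'.porfco a b := by
  refine TransGen.mono (fun c d hcd => ?_) _ _ h
  rcases hcd with hcd | ⟨x, hcd⟩
  · exact Or.inl (by rwa [hw.porf_eq])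
  · exact Or.inr ⟨x, hw.2.2.2.2.2 x c d hcd⟩

/-- A nonempty set of transactions of an acyclic finite trace has a `(po ∪ rf ∪ co)⁺`-maximal
element. -/
theorem exists_maximal_porfco {τ : CCvTrace α V} (hfin : τ.T.Finite)
    (hirr : ∀ a, ¬ TransGen τ.porfco a a) {S : Set α} (hS : S ⊆ τ.T) (hne : S.Nonempty) :
    ∃ m ∈ S, ∀ s ∈ S, ¬ TransGen τ.porfco m s := by
  let r : α → α → Prop := fun a b => TransGen τ.porfco b a
  have : IsStrictOrder α r :=
    { irrefl := hirr
      trans := fun _ _ _ hab hbc => TransGen.trans hbc hab }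
  have hwf : S.WellFoundedOn r := (hfin.subset hS).wellFoundedOn
  obtain ⟨s, hs⟩ := hne
  obtain ⟨m, -, hm⟩ := WellFounded.has_min hwf Set.univ ⟨⟨s, hs⟩, trivial⟩
  exact ⟨m, m.2, fun u hu => hm ⟨u, hu⟩ trivial⟩

theorem Weaker.cond1_mono {τ τ' : CCvTrace α V} (hw : τ.Weaker τ') {x : V} {t t' : α}
    (h : τ.cond1 x t t') : τ'.cond1 x t t' := by
  obtain ⟨t₃, h₃, h₁, h₂⟩ := h
  exact ⟨t₃, hw.2.1 ▸ h₃, hw.transGen_porfco h₁, by rwa [hw.porf_eq]⟩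

theorem Weaker.cond2_mono {τ τ' : CCvTrace α V} (hw : τ.Weaker τ') {x : V} {t t' : α}
    (h : τ.cond2 x t t') : τ'.cond2 x t t' := by
  obtain ⟨-, hW, -, -, hrf, -⟩ := hw
  simpa only [cond2, hW, hrf] using h

theorem Weaker.cond3_mono {τ τ' : CCvTrace α V} (hw : τ.Weaker τ') {x : V} {t t' : α}
    (h : τ.cond3 x t t') : τ'.cond3 x t t' := by
  obtain ⟨y, t₃, t₄, hy, ht', hrf, h₄₃, h₃, hW⟩ := h
  exact ⟨y, t₃, t₄, hy, hw.2.1 ▸ ht', hw.2.2.2.2.1 ▸ hrf, hw.transGen_porfco h₄₃,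
    by rwa [hw.porf_eq], hw.2.1 ▸ hW⟩

theorem Weaker.cond4_mono {τ τ' : CCvTrace α V} (hw : τ.Weaker τ') (hfin : τ'.T.Finite)
    (hirr : ∀ a, ¬ TransGen τ'.porfco a a) {x : V} {t t' : α}
    (h : τ.cond4 x t t') : τ'.cond4 x t t' := by
  obtain ⟨y, t₃, t₄, hy, ht', hrf, h₄₃, h₃, hW, -⟩ := h
  obtain ⟨m, ⟨hmW, hm, hmt⟩, hmax⟩ := exists_maximal_porfco hfin hirr
    (S := {s | s ∈ τ'.W x ∧ TransGen τ'.porfco t₄ s ∧ TransGen τ'.porf s t})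
    (fun s hs => τ'.W_sub x hs.1)
    ⟨t₃, hw.2.1 ▸ hW, hw.transGen_porfco h₄₃, by rwa [hw.porf_eq]⟩
  exact ⟨y, m, t₄, hy, hw.2.1 ▸ ht', hw.2.2.2.2.1 ▸ hrf, hm, hmt, hmW,
    fun ⟨u, huW, hmu, hut⟩ => hmax u ⟨huW, hm.trans hmu, hut⟩ hmu⟩

end CCvTrace

open Relation CCvTrace in
/-- if τ ⊑ τ' with finite transaction set and `(po ∪ rf ∪ co')⁺`
irreflexive, then readable sets only shrink: `rbl(τ', t, x) ⊆ rbl(τ, t, x)`. -/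
theorem rbl_antitone {α V : Type*} (τ τ' : CCvTrace α V)
    (hfin : τ.T.Finite) (hw : τ.Weaker τ')
    (hirr : ∀ a, ¬ TransGen τ'.porfco a a) :
    ∀ (x : V) (t : α), t ∈ τ.R x → τ'.rbl t x ⊆ τ.rbl t x := by
  rintro x t - t' ⟨hW, h₁, h₂, h₃, h₄⟩
  exact ⟨hw.2.1 ▸ hW, fun h => h₁ (hw.cond1_mono h), fun h => h₂ (hw.cond2_mono h),
    fun h => h₃ (hw.cond3_mono h), fun h => h₄ (hw.cond4_mono (hw.1 ▸ hfin) hirr h)⟩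
end

section
/- Let τ be a fulfilled CC trace and let τ' be obtained from τ by a begin step, adding a fresh transaction t ∉ T together with a single new po edge (t₀, t) for some t₀ ∈ T, and leaving rf unchanged. Then τ' is fulfilled. -/
open Relation

/-- A CC trace: transactions `T`, per-variable write/read sets `W`, `R`,
program order `po` and per-variable reads-from `rf`. -/
structure CCTrace (α V : Type*) where
  T : Set α
  W : V → Set α
  R : V → Set α
  po : α → α → Prop
  rf : V → α → α → Prop
  W_sub : ∀ x, W x ⊆ T
  R_sub : ∀ x, R x ⊆ T
  po_mem : ∀ a b, po a b → a ∈ T ∧ b ∈ T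
  rf_mem : ∀ x a b, rf x a b → a ∈ W x ∧ b ∈ R x

namespace CCTrace

variable {α V : Type*}

/-- The union of the reads-from relations over all variables. -/
def rfU (τ : CCTrace α V) (a b : α) : Prop := ∃ x, τ.rf x a b

/-- po ∪ rf. -/
def porf (τ : CCTrace α V) (a b : α) : Prop := τ.po a b ∨ τ.rfU a b

/-- Two transactions are concurrent if they are incomparable in `(po ∪ rf)⁺`. -/
def Concurrent (τ : CCTrace α V) (a b : α) : Prop :=
  ¬ TransGen τ.porf a b ∧ ¬ TransGen τ.porf b a

/-- A CC trace is fulfilled if whenever `(po ∪ rf)⁺ t t''` and `rf^x t' t''`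
for writers t, t' of x, then t and t' are concurrent or `(po ∪ rf)* t t'`. -/
def Fulfilled (τ : CCTrace α V) : Prop :=
  ∀ x t t' t'', t ∈ τ.W x → t' ∈ τ.W x →
    TransGen τ.porf t t'' → τ.rf x t' t'' →
    τ.Concurrent t t' ∨ ReflTransGen τ.porf t t'

/-- τ ⊨ CC (partially good). -/
def SatCC (τ : CCTrace α V) : Prop :=
  (∀ x t₁ t₂ t₃, t₁ ∈ τ.W x → t₃ ∈ τ.W x → t₂ ∈ τ.R x →
      τ.rf x t₁ t₂ → TransGen τ.porf t₃ t₂ →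
      τ.Concurrent t₃ t₁ ∨ ReflTransGen τ.porf t₃ t₁) ∧
  (∀ a, ¬ TransGen τ.porf a a)

/-- cc-cond1 for a candidate source `t'` of a read of `x` in `t`. -/
def ccCond1 (τ : CCTrace α V) (x : V) (t t' : α) : Prop :=
  ∃ t₃, t₃ ∈ τ.W x ∧ TransGen τ.porf t' t₃ ∧ TransGen τ.porf t₃ t

/-- cc-cond2. -/
def ccCond2 (τ : CCTrace α V) (x : V) (t t' : α) : Prop :=
  ∃ y t₃ t₄, y ≠ x ∧ τ.rf y t₄ t ∧ TransGen τ.porf t₄ t₃ ∧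
    ReflTransGen τ.porf t₃ t' ∧ t₃ ∈ τ.W y

/-- The CC readable set rbl(τ, t, x). -/
def rbl (τ : CCTrace α V) (t : α) (x : V) : Set α :=
  {t' | t' ∈ τ.W x ∧ ¬ τ.ccCond1 x t t' ∧ ¬ τ.ccCond2 x t t'}

/-- `t` has no outgoing po or rf edges. -/
def NoOut (τ : CCTrace α V) (t : α) : Prop :=
  (∀ s, ¬ τ.po t s) ∧ (∀ y s, ¬ τ.rf y t s)

/-- The begin step: add a fresh transaction `t ∉ T` with one new po edge `(t₀, t)`. -/
def beginStep (τ : CCTrace α V) (t t₀ : α) (hnew : t ∉ τ.T) (h₀ : t₀ ∈ τ.T) :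
    CCTrace α V where
  T := τ.T ∪ {t}
  W := τ.W
  R := τ.R
  po := fun a b => τ.po a b ∨ (a = t₀ ∧ b = t)
  rf := τ.rf
  W_sub := fun x a ha => Set.mem_union_left _ (τ.W_sub x ha)
  R_sub := fun x a ha => Set.mem_union_left _ (τ.R_sub x ha)
  po_mem := by
    rintro a b (h | ⟨ha, hb⟩)
    · exact ⟨Set.mem_union_left _ (τ.po_mem a b h).1, Set.mem_union_left _ (τ.po_mem a b h).2⟩
    · exact ⟨ha ▸ Set.mem_union_left _ h₀, Set.mem_union_right _ hb⟩
  rf_mem := τ.rf_mem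

/-- The CC read step: `t ∈ R x` reads `x` from `t' ∈ rbl(τ, t, x)`:
add the rf^x edge (t', t). -/
def readStep (τ : CCTrace α V) (x : V) (t t' : α)
    (ht : t ∈ τ.R x) (ht' : t' ∈ τ.rbl t x) : CCTrace α V where
  T := τ.T
  W := τ.W
  R := τ.R
  po := τ.po
  rf := fun y a b => τ.rf y a b ∨ (y = x ∧ a = t' ∧ b = t)
  W_sub := τ.W_sub
  R_sub := τ.R_sub
  po_mem := τ.po_mem
  rf_mem := by
    rintro y a b (h | ⟨rfl, rfl, rfl⟩)
    · exact τ.rf_mem y a b h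
    · exact ⟨ht'.1, ht⟩

end CCTrace

namespace CCTrace

variable {α V : Type*} {τ : CCTrace α V} {t t₀ a b : α} {hnew : t ∉ τ.T} {h₀ : t₀ ∈ τ.T}

theorem porf_mem (h : τ.porf a b) : a ∈ τ.T ∧ b ∈ τ.T := by
  rcases h with h | ⟨x, h⟩
  · exact τ.po_mem a b h
  · exact ⟨τ.W_sub x (τ.rf_mem x a b h).1, τ.R_sub x (τ.rf_mem x a b h).2⟩

theorem porf_beginStep :
    (τ.beginStep t t₀ hnew h₀).porf a b ↔ τ.porf a b ∨ (a = t₀ ∧ b = t) :=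
  or_right_comm

theorem transGen_porf_beginStep (hb : b ∈ τ.T) :
    TransGen (τ.beginStep t t₀ hnew h₀).porf a b ↔ TransGen τ.porf a b := by
  refine ⟨fun h => ?_, TransGen.mono (fun _ _ h => porf_beginStep.2 (Or.inl h)) _ _⟩
  induction h with
  | single h =>
    rcases porf_beginStep.1 h with h | ⟨-, rfl⟩
    · exact .single h
    · exact absurd hb hnew
  | tail _ h ih =>
    rcases porf_beginStep.1 h with h | ⟨-, rfl⟩
    · exact (ih (porf_mem h).1).tail h
    · exact absurd hb hnew

theorem reflTransGen_porf_beginStep (hb : b ∈ τ.T) :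
    ReflTransGen (τ.beginStep t t₀ hnew h₀).porf a b ↔ ReflTransGen τ.porf a b := by
  simp only [reflTransGen_iff_eq_or_transGen, transGen_porf_beginStep hb]

theorem concurrent_beginStep (ha : a ∈ τ.T) (hb : b ∈ τ.T) :
    (τ.beginStep t t₀ hnew h₀).Concurrent a b ↔ τ.Concurrent a b := by
  simp only [Concurrent, transGen_porf_beginStep ha, transGen_porf_beginStep hb]

end CCTrace

open Relation CCTrace in
/-- the CC begin step preserves fulfilledness. -/
theorem cc_fulfilled_beginStep {α V : Type*} (τ : CCTrace α V) (t t₀ : α)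
    (hnew : t ∉ τ.T) (h₀ : t₀ ∈ τ.T) (hful : τ.Fulfilled) :
    (τ.beginStep t t₀ hnew h₀).Fulfilled := by
  intro x a b c ha hb hac hbc
  have haT := τ.W_sub x ha
  have hbT := τ.W_sub x hb
  have hcT := τ.R_sub x (τ.rf_mem x b c hbc).2
  rw [concurrent_beginStep haT hbT, reflTransGen_porf_beginStep hbT]
  exact hful x a b c ha hb ((transGen_porf_beginStep hcT).1 hac) hbc
end

section
/- With the event relations B₁ and B₂ built from a trace as in the construction below, for every event e₁ ∈ E with underlying transaction t₁ and every issue event isu(q, t₂) ∈ E, if the pair (e₁, isu(q, t₂)) lies in (B₁ ∪ B₂)⁺, then hb t₁ t₂. -/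
open Relation

open Relation

/-- Events: issue and delivery events, tagged with a process and a transaction. -/
inductive Ev (P α : Type*) where
  | isu : P → α → Ev P α
  | del : P → α → Ev P α

namespace Ev

variable {P α : Type*}

/-- The process of an event. -/
def procOf : Ev P α → P
  | .isu p _ => p
  | .del p _ => p

/-- The underlying transaction of an event. -/
def transOf : Ev P α → α
  | .isu _ t => t
  | .del _ t => t

end Ev

namespace CCvTrace

variable {α V P : Type*}

/-- The happens-before relation hb = (po ∪ rf)⁺. -/
def hb (τ : CCvTrace α V) : α → α → Prop := TransGen τ.porf

/-- The set W of all transactions writing some variable. -/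
def Wall (τ : CCvTrace α V) : Set α := {a | ∃ x, a ∈ τ.W x}

/-- A_p : the transactions of process p. -/
def Aset (τ : CCvTrace α V) (proc : α → P) (p : P) : Set α :=
  {a | a ∈ τ.T ∧ proc a = p}

/-- A'_p = A_p ∪ W. -/
def Aset' (τ : CCvTrace α V) (proc : α → P) (p : P) : Set α :=
  τ.Aset proc p ∪ τ.Wall

/-- The order <_p on transactions used to build the event relations. -/
def ltp (τ : CCvTrace α V) (proc : α → P) (p : P) (a b : α) : Prop :=
  (a ∈ τ.Aset' proc p ∧ b ∈ τ.Aset' proc p ∧ τ.hb a b) ∨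
  (a ∈ τ.Aset proc p ∧ b ∈ τ.Aset' proc p ∧ b ∉ τ.Aset proc p ∧ ¬ τ.hb b a)

/-- The event set E: issue events isu(p, t) for t ∈ A_p and delivery events
del(p, t) for t ∈ A'_p \ A_p. -/
def Eset (τ : CCvTrace α V) (proc : α → P) : Set (Ev P α) :=
  {e | match e with
       | Ev.isu p a => a ∈ τ.Aset proc p
       | Ev.del p a => a ∈ τ.Aset' proc p ∧ a ∉ τ.Aset proc p}

/-- B₁ relates two events of a common process p whose underlying transactions
are ordered by <_p. -/
def B1 (τ : CCvTrace α V) (proc : α → P) (e₁ e₂ : Ev P α) : Prop :=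
  e₁ ∈ τ.Eset proc ∧ e₂ ∈ τ.Eset proc ∧ e₁.procOf = e₂.procOf ∧
  τ.ltp proc e₁.procOf e₁.transOf e₂.transOf

/-- B₂ relates the issue of each writing transaction to each of its deliveries. -/
def B2 (τ : CCvTrace α V) (proc : α → P) (e₁ e₂ : Ev P α) : Prop :=
  ∃ (a : α) (p : P), a ∈ τ.Wall ∧ a ∈ τ.Aset' proc p ∧ a ∉ τ.Aset proc p ∧
    e₁ = Ev.isu (proc a) a ∧ e₂ = Ev.del p a

/-- B₃ relates issue events along the coherence order. -/
def B3 (τ : CCvTrace α V) (proc : α → P) (e₁ e₂ : Ev P α) : Prop :=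
  ∃ a b, τ.coU a b ∧ e₁ = Ev.isu (proc a) a ∧ e₂ = Ev.isu (proc b) b

end CCvTrace

namespace CCvTrace

variable {α V P : Type*}

/-- `τ.Precedes proc s e`: the event `e` is the issue of `s` or its transaction happens before `s`,
and every transaction of the process of `e` that does not follow `e` happens before `s`. -/
def Precedes (τ : CCvTrace α V) (proc : α → P) (s : α) (e : Ev P α) : Prop :=
  ((∃ p, e = Ev.isu p s) ∨ τ.hb e.transOf s) ∧
  ∀ t ∈ τ.Aset proc e.procOf, t ≠ e.transOf → ¬ τ.hb e.transOf t → τ.hb t s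

theorem precedes_isu {τ : CCvTrace α V} {proc : α → P}
    (htot : ∀ a b, a ∈ τ.T → b ∈ τ.T → a ≠ b → proc a = proc b → τ.hb a b ∨ τ.hb b a)
    {s t : α} {p : P} (ht : t ∈ τ.Aset proc p) (h : t = s ∨ τ.hb t s) :
    τ.Precedes proc s (Ev.isu p t) := by
  refine ⟨h.imp_left fun h => ⟨p, by rw [h]⟩, fun u hu hne hnot => ?_⟩
  have hut : τ.hb u t :=
    (htot u t hu.1 ht.1 hne (hu.2.trans ht.2.symm)).resolve_right hnot
  rcases h with rfl | h
  · exact hut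
  · exact TransGen.trans hut h

theorem Precedes.hb_of_step {τ : CCvTrace α V} {proc : α → P} {s : α} {e e' : Ev P α}
    (h : τ.Precedes proc s e') (hstep : τ.B1 proc e e' ∨ τ.B2 proc e e') :
    τ.hb e.transOf s := by
  rcases hstep with ⟨-, -, hp, ⟨-, -, hlt⟩ | ⟨ha, -, hb, hnot⟩⟩ | ⟨a, p, -, -, -, rfl, rfl⟩
  · rcases h.1 with ⟨p, rfl⟩ | h
    · exact hlt
    · exact TransGen.trans hlt h
  · exact h.2 _ (hp ▸ ha) (fun heq => hb (heq ▸ ha)) hnot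
  · rcases h.1 with ⟨p, h⟩ | h
    · cases h
    · exact h

theorem Precedes.of_step {τ : CCvTrace α V} {proc : α → P}
    (htot : ∀ a b, a ∈ τ.T → b ∈ τ.T → a ≠ b → proc a = proc b → τ.hb a b ∨ τ.hb b a)
    {s : α} {e e' : Ev P α}
    (h : τ.Precedes proc s e') (hstep : τ.B1 proc e e' ∨ τ.B2 proc e e') :
    τ.Precedes proc s e := by
  have hes := h.hb_of_step hstep
  rcases hstep with ⟨he, -, hp, hlt⟩ | ⟨a, p, ⟨x, hx⟩, -, -, rfl, -⟩
  · cases e with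
    | isu p t => exact precedes_isu htot he (Or.inr hes)
    | del p t =>
      rcases hlt with ⟨-, -, hlt⟩ | ⟨ha, -⟩
      · refine ⟨Or.inr hes, fun u hu _ hnot => h.2 u (hp ▸ hu) ?_ fun h' =>
          hnot (TransGen.trans hlt h')⟩
        rintro rfl
        exact hnot hlt
      · exact absurd ha he.2
  · exact precedes_isu htot ⟨τ.W_sub x hx, rfl⟩ (Or.inr hes)

end CCvTrace

open Relation CCvTrace in
/-- any (B₁ ∪ B₂)⁺ path from an event e₁ ∈ E to an issue event
isu(q, t₂) ∈ E yields hb between the underlying transactions. -/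
theorem transGen_B1B2_to_isu_hb {α V P : Type*} (τ : CCvTrace α V) (proc : α → P)
    (hirr : ∀ a, ¬ τ.hb a a)
    (htot : ∀ a b, a ∈ τ.T → b ∈ τ.T → a ≠ b → proc a = proc b → τ.hb a b ∨ τ.hb b a)
    (e₁ : Ev P α) (he₁ : e₁ ∈ τ.Eset proc) (q : P) (t₂ : α)
    (he₂ : Ev.isu q t₂ ∈ τ.Eset proc)
    (hpath : TransGen (fun u v => τ.B1 proc u v ∨ τ.B2 proc u v) e₁ (Ev.isu q t₂)) :
    τ.hb e₁.transOf t₂ := by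
  obtain ⟨e, hstep, hrest⟩ := TransGen.head'_iff.mp hpath
  refine Precedes.hb_of_step ?_ hstep
  clear hstep
  induction hrest using ReflTransGen.head_induction_on with
  | refl => exact precedes_isu htot he₂ (Or.inl rfl)
  | head hstep _ ih => exact ih.of_step htot hstep
end

section
/- With the event relations B₁ and B₂ built from a trace as in the construction below, the relation (B₁ ∪ B₂)⁺ on the event set E is irreflexive. -/
open Relation

open Relation

namespace CCvTrace

variable {α V P : Type*}

/-- What reachability from the issue of `a` guarantees about an event: an issued transaction
happens after `a`, and so does every transaction of `p` that happens after one delivered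
to `p`. -/
def FollowsIssue (τ : CCvTrace α V) (proc : α → P) (a : α) : Ev P α → Prop
  | .isu _ c => τ.hb a c
  | .del p b => ∀ c ∈ τ.Aset proc p, τ.hb b c → τ.hb a c

theorem followsIssue_of_step_isu (τ : CCvTrace α V) (proc : α → P)
    (htot : ∀ a b, a ∈ τ.T → b ∈ τ.T → a ≠ b → proc a = proc b → τ.hb a b ∨ τ.hb b a)
    {p : P} {a : α} {v : Ev P α}
    (h : τ.B1 proc (.isu p a) v ∨ τ.B2 proc (.isu p a) v) : τ.FollowsIssue proc a v := by
  rcases h with ⟨ha, hv, hp, hlt⟩ | ⟨b, q, -, -, -, hu, rfl⟩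
  · cases v with
    | isu q c =>
      obtain rfl : p = q := hp
      rcases hlt with ⟨-, -, h⟩ | ⟨-, -, hc, -⟩
      · exact h
      · exact absurd hv hc
    | del q b =>
      obtain rfl : p = q := hp
      intro c hc hbc
      rcases hlt with ⟨-, -, h⟩ | ⟨-, -, -, hn⟩
      · exact TransGen.trans h hbc
      · have hn : ¬ τ.hb b a := hn
        have hac : a ≠ c := by
          rintro rfl
          exact hn hbc
        rcases htot a c ha.1 hc.1 hac (ha.2.trans hc.2.symm) with h | h
        · exact h
        · exact absurd (TransGen.trans hbc h) hn
  · cases hu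
    exact fun c _ h => h

/-- A step out of a delivery stays in the process and follows happens-before. -/
theorem step_del (τ : CCvTrace α V) (proc : α → P) {p : P} {b : α} {v : Ev P α}
    (h : τ.B1 proc (.del p b) v ∨ τ.B2 proc (.del p b) v) :
    v ∈ τ.Eset proc ∧ v.procOf = p ∧ τ.hb b v.transOf := by
  rcases h with ⟨hb, hv, hp, ⟨-, -, h⟩ | ⟨h, -⟩⟩ | ⟨_, _, -, -, -, hu, -⟩
  · exact ⟨hv, hp.symm, h⟩
  · exact absurd h hb.2
  · cases hu

theorem followsIssue_of_transGen (τ : CCvTrace α V) (proc : α → P)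
    (htot : ∀ a b, a ∈ τ.T → b ∈ τ.T → a ≠ b → proc a = proc b → τ.hb a b ∨ τ.hb b a)
    {p : P} {a : α} {v : Ev P α}
    (h : TransGen (fun u v => τ.B1 proc u v ∨ τ.B2 proc u v) (.isu p a) v) :
    τ.FollowsIssue proc a v := by
  induction h with
  | single h => exact followsIssue_of_step_isu τ proc htot h
  | @tail u v _ h ih =>
    cases u with
    | isu q d =>
      have hd := followsIssue_of_step_isu τ proc htot h
      cases v with
      | isu r c => exact TransGen.trans ih hd
      | del r b => exact fun c hc hbc => TransGen.trans ih (hd c hc hbc)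
    | del q b =>
      obtain ⟨hv, rfl, hbv⟩ := step_del τ proc h
      cases v with
      | isu r c => exact ih c hv hbv
      | del r b' => exact fun c hc hbc => ih c hc (TransGen.trans hbv hbc)

/-- A path from a delivery either follows happens-before or meets an issue event. -/
theorem hb_or_exists_isu_of_transGen_del (τ : CCvTrace α V) (proc : α → P)
    {p : P} {b : α} {v : Ev P α}
    (h : TransGen (fun u v => τ.B1 proc u v ∨ τ.B2 proc u v) (.del p b) v) :
    τ.hb b v.transOf ∨ ∃ q a,
      TransGen (fun u v => τ.B1 proc u v ∨ τ.B2 proc u v) (.del p b) (.isu q a) ∧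
      ReflTransGen (fun u v => τ.B1 proc u v ∨ τ.B2 proc u v) (.isu q a) v := by
  induction h with
  | single h => exact .inl (step_del τ proc h).2.2
  | @tail u v hu h ih =>
    rcases ih with ih | ⟨q, a, h₁, h₂⟩
    · cases u with
      | isu q a => exact .inr ⟨q, a, hu, .single h⟩
      | del q c => exact .inl (TransGen.trans ih (step_del τ proc h).2.2)
    · exact .inr ⟨q, a, h₁, h₂.tail h⟩

end CCvTrace

open Relation CCvTrace in
/-- the relation (B₁ ∪ B₂)⁺ on events is irreflexive. -/
theorem transGen_B1B2_irrefl {α V P : Type*} (τ : CCvTrace α V) (proc : α → P)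
    (hirr : ∀ a, ¬ τ.hb a a)
    (htot : ∀ a b, a ∈ τ.T → b ∈ τ.T → a ≠ b → proc a = proc b → τ.hb a b ∨ τ.hb b a) :
    ∀ e : Ev P α, ¬ TransGen (fun u v => τ.B1 proc u v ∨ τ.B2 proc u v) e e := by
  have hisu : ∀ p a,
      ¬ TransGen (fun u v => τ.B1 proc u v ∨ τ.B2 proc u v) (.isu p a) (.isu p a) :=
    fun p a h => hirr a (followsIssue_of_transGen τ proc htot h)
  intro e h
  cases e with
  | isu p a => exact hisu p a h
  | del p b =>
    rcases hb_or_exists_isu_of_transGen_del τ proc h with h | ⟨q, a, h₁, h₂⟩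
    · exact hirr b h
    · exact hisu q a (TransGen.trans_right h₂ h₁)
end
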